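/- arXiv:0904.1699 — 3 statements merged into one kernel-verified Lean document; each statement's English description precedes it below -/
import Mathlib

section
/- For all integers x, y with 0 ≤ y < x, the function w := v_x − v_y lies in H_ℤ and is a dipole for the pair (x, y): for every u ∈ H_ℤ one has ⟨w, u⟩_E = u(x) − u(y); in particular ⟨v_x, u⟩_E = u(x) − u(0) for every u ∈ H_ℤ and every integer x ≥ 1. -/
open Complex

/-- The dipole `v_x : ℤ → ℂ`, `v_x n = min (max n 0) x`. -/
noncomputable def vdip (x : ℤ) : ℤ → ℂ := fun n => ((min (max n 0) x : ℤ) : ℂ)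

/-- Membership in the energy Hilbert space `H_ℤ`: finite energy. -/
def FiniteEnergyZ (u : ℤ → ℂ) : Prop :=
  Summable fun n : ℤ => ‖u n - u (n + 1)‖ ^ 2

/-- The energy inner product on `H_ℤ`. -/
noncomputable def energyInnerZ (w u : ℤ → ℂ) : ℂ :=
  ∑' n : ℤ, (starRingEnd ℂ) (w n - w (n + 1)) * (u n - u (n + 1))

theorem vdip_sub_vdip_succ_diff {x y : ℤ} (hy : 0 ≤ y) (hyx : y ≤ x) (n : ℤ) :
    (vdip x n - vdip y n) - (vdip x (n + 1) - vdip y (n + 1)) =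
      if n ∈ Finset.Ico y x then -1 else 0 := by
  have key : (min (max n 0) x - min (max n 0) y) -
      (min (max (n + 1) 0) x - min (max (n + 1) 0) y) =
      if n ∈ Finset.Ico y x then (-1 : ℤ) else 0 := by
    simp only [Finset.mem_Ico]
    split_ifs <;> omega
  unfold vdip
  exact_mod_cast congrArg (Int.cast : ℤ → ℂ) key

theorem sum_Ico_int_succ_sub {G : Type*} [AddCommGroup G] (u : ℤ → G) {x y : ℤ} (hyx : y ≤ x) :
    ∑ n ∈ Finset.Ico y x, (u (n + 1) - u n) = u x - u y := by
  induction x, hyx using Int.leInduction with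
  | base => simp
  | succ x hx ih =>
    rw [← Finset.insert_Ico_right_eq_Ico_add_one hx, Finset.sum_insert (by simp), ih]
    abel

theorem finiteEnergyZ_vdip_sub_vdip {x y : ℤ} (hy : 0 ≤ y) (hyx : y ≤ x) :
    FiniteEnergyZ (fun n => vdip x n - vdip y n) := by
  refine summable_of_ne_finset_zero (s := Finset.Ico y x) fun n hn => ?_
  rw [vdip_sub_vdip_succ_diff hy hyx, if_neg hn]
  simp

theorem energyInnerZ_vdip_sub_vdip {x y : ℤ} (hy : 0 ≤ y) (hyx : y ≤ x) (u : ℤ → ℂ) :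
    energyInnerZ (fun n => vdip x n - vdip y n) u = u x - u y := by
  unfold energyInnerZ
  simp only [vdip_sub_vdip_succ_diff hy hyx]
  rw [tsum_eq_sum (s := Finset.Ico y x) fun n hn => by rw [if_neg hn, map_zero, zero_mul],
    ← sum_Ico_int_succ_sub u hyx]
  refine Finset.sum_congr rfl fun n hn => ?_
  rw [if_pos hn]
  simp

theorem vdip_zero : vdip 0 = 0 := by
  funext n
  simp [vdip]

/-- **(Lemma 2.5, dipole part.)** For integers `0 ≤ y < x`, the function `w := v_x - v_y`
lies in `H_ℤ` and is a dipole for the pair `(x, y)`: `⟨w, u⟩_E = u x - u y` for every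
`u ∈ H_ℤ`; in particular `⟨v_x, u⟩_E = u x - u 0` for all `u ∈ H_ℤ` and `x ≥ 1`. -/
theorem stmt_1 :
    (∀ x y : ℤ, 0 ≤ y → y < x →
      FiniteEnergyZ (fun n => vdip x n - vdip y n) ∧
      ∀ u : ℤ → ℂ, FiniteEnergyZ u →
        energyInnerZ (fun n => vdip x n - vdip y n) u = u x - u y) ∧
    (∀ x : ℤ, 1 ≤ x → ∀ u : ℤ → ℂ, FiniteEnergyZ u →
      energyInnerZ (vdip x) u = u x - u 0) := by
  refine ⟨fun x y hy hyx => ⟨finiteEnergyZ_vdip_sub_vdip hy hyx.le,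
    fun u _ => energyInnerZ_vdip_sub_vdip hy hyx.le u⟩, fun x hx u _ => ?_⟩
  simpa [vdip_zero] using energyInnerZ_vdip_sub_vdip le_rfl (zero_le_one.trans hx) u
end

section
/- Assume C(x) := ∑_{y∈V} c(x,y) < ∞ for every x ∈ V, and let u : V → ℂ have finite energy in the sense that ∑_{x∈V} ∑_{y∈V} c(x,y)·|u(x) − u(y)|² < ∞. Then for every x ∈ V the sum ∑_{y∈V} c(x,y)·(u(x) − u(y)) converges absolutely and E(δ_x, u) = ∑_{y∈V} c(x,y)·(u(x) − u(y)); that is, pairing against δ_x in the energy form computes the graph Laplacian of u at x. -/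
open Complex

/-- The Dirac function at a vertex. -/
noncomputable def dirac {V : Type*} [DecidableEq V] (x : V) : V → ℂ :=
  fun y => if y = x then 1 else 0

/-- The integrand of the graph energy form
`E(u,v) = (1/2) ∑∑ c x y · conj (u x - u y) · (v x - v y)` as a function of the pair. -/
noncomputable def energyTerm {V : Type*} (c : V → V → ℝ) (u v : V → ℂ) (p : V × V) : ℂ :=
  (c p.1 p.2 : ℂ) * (starRingEnd ℂ) (u p.1 - u p.2) * (v p.1 - v p.2)

/-- **(Theorem 4.7, equation (4.23)).** Assume `C x := ∑_y c x y < ∞` for all `x`, and let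
`u` have finite energy.  Then for each `x` the sum `∑_y c x y (u x - u y)` converges
absolutely and `E(δ_x, u) = ∑_y c x y (u x - u y)`: pairing against `δ_x` in the energy
form computes the graph Laplacian of `u` at `x`. -/
theorem stmt_10 {V : Type*} [DecidableEq V] (c : V → V → ℝ)
    (hsymm : ∀ x y : V, c x y = c y x) (hnonneg : ∀ x y : V, 0 ≤ c x y)
    (hdiag : ∀ x : V, c x x = 0)
    (hC : ∀ x : V, Summable fun y : V => c x y)
    (u : V → ℂ)
    (hu : Summable fun p : V × V => c p.1 p.2 * ‖u p.1 - u p.2‖ ^ 2) :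
    ∀ x : V,
      (Summable fun y : V => ‖(c x y : ℂ) * (u x - u y)‖) ∧
      Summable (energyTerm c (dirac x) u) ∧
      (1 / 2 : ℂ) * ∑' p : V × V, energyTerm c (dirac x) u p
        = ∑' y : V, (c x y : ℂ) * (u x - u y) := by
  intro x
  have hnorm : Summable fun y : V => ‖(c x y : ℂ) * (u x - u y)‖ := by
    have hx : Summable fun y : V => c x y * ‖u x - u y‖ ^ 2 :=
      hu.comp_injective (Prod.mk_right_injective x)
    refine ((hC x).add hx).of_nonneg_of_le (fun y => norm_nonneg _) fun y => ?_
    rw [norm_mul, norm_real, Real.norm_of_nonneg (hnonneg x y)]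
    nlinarith [mul_nonneg (hnonneg x y) (sq_nonneg (‖u x - u y‖ - 1)),
      mul_nonneg (hnonneg x y) (norm_nonneg (u x - u y))]
  have hrow : HasSum (fun p : V × V => if p.1 = x then (c x p.2 : ℂ) * (u x - u p.2) else 0)
      (∑' y : V, (c x y : ℂ) * (u x - u y)) := by
    refine ((Prod.mk_right_injective x).hasSum_iff ?_).1 ?_
    · rintro ⟨a, b⟩ hab
      exact if_neg fun h => hab ⟨b, by simp_all⟩
    · simpa [Function.comp_def] using hnorm.of_norm.hasSum
  have hcol := (Equiv.prodComm V V).hasSum_iff.2 hrow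
  have henergy : HasSum (energyTerm c (dirac x) u)
      ((∑' y : V, (c x y : ℂ) * (u x - u y)) + ∑' y : V, (c x y : ℂ) * (u x - u y)) := by
    convert hrow.add hcol using 1
    ext ⟨a, b⟩
    by_cases ha : a = x <;> by_cases hb : b = x
    · simp [energyTerm, dirac, ha, hb]
    · simp [energyTerm, dirac, ha, hb]
    · simp [energyTerm, dirac, ha, hb, hsymm a x]
      ring
    · simp [energyTerm, dirac, ha, hb]
  refine ⟨hnorm, henergy.summable, ?_⟩
  rw [henergy.tsum_eq]
  ring
end

section
/- Assume C(x) := ∑_{y∈V} c(x,y) < ∞ for every x ∈ V. Let ξ : V → ℂ satisfy ∑_{x∈V} C(x)·|ξ(x)|² < ∞ and let u : V → ℂ satisfy ∑_{x∈V} ∑_{y∈V} c(x,y)·|u(x) − u(y)|² < ∞. Then for each x ∈ V the sum (Δu)(x) := ∑_{y∈V} c(x,y)·(u(x) − u(y)) converges absolutely, and ∑_{x∈V} |ξ(x)|·|(Δu)(x)| ≤ (∑_{x∈V} C(x)·|ξ(x)|²)^{1/2} · (∑_{x∈V} ∑_{y∈V} c(x,y)·|u(x) − u(y)|²)^{1/2}.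 In particular the weighted ℓ²-space ℓ²(V, C) is boundedly embedded into the dual of the energy space via ξ ↦ (u ↦ ∑_x ξ(x)·(Δu)(x)). -/
open Complex

/-- Cauchy–Schwarz for nonnegative families of real numbers. -/
theorem summable_mul_and_tsum_mul_le_sqrt_mul_sqrt {ι : Type*} {f g : ι → ℝ}
    (hf : ∀ i, 0 ≤ f i) (hg : ∀ i, 0 ≤ g i)
    (hf2 : Summable fun i => f i ^ 2) (hg2 : Summable fun i => g i ^ 2) :
    (Summable fun i => f i * g i) ∧
      ∑' i, f i * g i ≤ √(∑' i, f i ^ 2) * √(∑' i, g i ^ 2) := by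
  have h := Real.summable_and_inner_le_Lp_mul_Lq_tsum_of_nonneg Real.HolderConjugate.two_two hf hg
    (by simpa using hf2) (by simpa using hg2)
  simpa [Real.sqrt_eq_rpow] using h

/-- Weighted Cauchy–Schwarz for nonnegative families of real numbers. -/
theorem summable_mul_and_tsum_mul_le_sqrt_mul_sqrt_of_weight {ι : Type*} {w g : ι → ℝ}
    (hw : ∀ i, 0 ≤ w i) (hg : ∀ i, 0 ≤ g i)
    (hws : Summable w) (hg2 : Summable fun i => w i * g i ^ 2) :
    (Summable fun i => w i * g i) ∧
      ∑' i, w i * g i ≤ √(∑' i, w i) * √(∑' i, w i * g i ^ 2) := by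
  have h := summable_mul_and_tsum_mul_le_sqrt_mul_sqrt (f := fun i => √(w i))
    (g := fun i => √(w i) * g i) (fun i => Real.sqrt_nonneg _)
    (fun i => mul_nonneg (Real.sqrt_nonneg _) (hg i))
    (by simpa [Real.sq_sqrt, hw] using hws) (by simpa [mul_pow, Real.sq_sqrt, hw] using hg2)
  simpa [mul_pow, Real.sq_sqrt, hw, ← mul_assoc, Real.mul_self_sqrt] using h

/-- **(Theorem 6.4.)** Assume `C x := ∑_y c x y < ∞` for all `x`, let `ξ` be in the weighted
`ℓ²`-space `ℓ²(V, C)` and let `u` have finite energy.  Then each Laplacian value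
`(Δu) x = ∑_y c x y (u x - u y)` converges absolutely, and
`∑_x |ξ x| |(Δu) x| ≤ (∑_x C x |ξ x|²)^{1/2} (∑_x ∑_y c x y |u x - u y|²)^{1/2}`;
in particular `ℓ²(V, C)` embeds contractively into the dual of the energy space via
`ξ ↦ (u ↦ ∑_x ξ x (Δu) x)`. -/
theorem stmt_18 {V : Type*} (c : V → V → ℝ)
    (hsymm : ∀ x y : V, c x y = c y x) (hnonneg : ∀ x y : V, 0 ≤ c x y)
    (hdiag : ∀ x : V, c x x = 0)
    (hC : ∀ x : V, Summable fun y : V => c x y)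
    (ξ : V → ℂ) (hξ : Summable fun x : V => (∑' y : V, c x y) * ‖ξ x‖ ^ 2)
    (u : V → ℂ) (hu : Summable fun p : V × V => c p.1 p.2 * ‖u p.1 - u p.2‖ ^ 2) :
    (∀ x : V, Summable fun y : V => ‖(c x y : ℂ) * (u x - u y)‖) ∧
    (Summable fun x : V => ‖ξ x‖ * ‖∑' y : V, (c x y : ℂ) * (u x - u y)‖) ∧
    ∑' x : V, ‖ξ x‖ * ‖∑' y : V, (c x y : ℂ) * (u x - u y)‖ ≤
      Real.sqrt (∑' x : V, (∑' y : V, c x y) * ‖ξ x‖ ^ 2) *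
        Real.sqrt (∑' p : V × V, c p.1 p.2 * ‖u p.1 - u p.2‖ ^ 2) := by
  have hnorm (x y : V) : ‖(c x y : ℂ) * (u x - u y)‖ = c x y * ‖u x - u y‖ := by
    rw [norm_mul, Complex.norm_of_nonneg (hnonneg x y)]
  have hfib (x : V) := summable_mul_and_tsum_mul_le_sqrt_mul_sqrt_of_weight (hnonneg x)
    (fun y => norm_nonneg (u x - u y)) (hC x) (hu.prod_factor x)
  have habs (x : V) : Summable fun y : V => ‖(c x y : ℂ) * (u x - u y)‖ := by
    simpa only [hnorm] using (hfib x).1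
  have hC0 (x : V) : 0 ≤ ∑' y, c x y := tsum_nonneg (hnonneg x)
  have hE0 (x : V) : 0 ≤ ∑' y, c x y * ‖u x - u y‖ ^ 2 :=
    tsum_nonneg fun y => mul_nonneg (hnonneg x y) (sq_nonneg _)
  have hle (x : V) : ‖ξ x‖ * ‖∑' y : V, (c x y : ℂ) * (u x - u y)‖ ≤
      (√(∑' y, c x y) * ‖ξ x‖) * √(∑' y, c x y * ‖u x - u y‖ ^ 2) := by
    have h : ‖∑' y : V, (c x y : ℂ) * (u x - u y)‖ ≤
        √(∑' y, c x y) * √(∑' y, c x y * ‖u x - u y‖ ^ 2) := by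
      refine (norm_tsum_le_tsum_norm (habs x)).trans ?_
      simpa only [hnorm] using (hfib x).2
    calc _ ≤ ‖ξ x‖ * (√(∑' y, c x y) * √(∑' y, c x y * ‖u x - u y‖ ^ 2)) := by gcongr
      _ = _ := by ring
  have hξsq (x : V) : (√(∑' y, c x y) * ‖ξ x‖) ^ 2 = (∑' y, c x y) * ‖ξ x‖ ^ 2 := by
    rw [mul_pow, Real.sq_sqrt (hC0 x)]
  have hEsq (x : V) : √(∑' y, c x y * ‖u x - u y‖ ^ 2) ^ 2 = ∑' y, c x y * ‖u x - u y‖ ^ 2 :=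
    Real.sq_sqrt (hE0 x)
  have hcs := summable_mul_and_tsum_mul_le_sqrt_mul_sqrt
    (f := fun x => √(∑' y, c x y) * ‖ξ x‖) (g := fun x => √(∑' y, c x y * ‖u x - u y‖ ^ 2))
    (fun x => mul_nonneg (Real.sqrt_nonneg _) (norm_nonneg _)) (fun x => Real.sqrt_nonneg _)
    (by simpa only [hξsq] using hξ) (by simpa only [hEsq] using hu.prod)
  simp only [hξsq, hEsq] at hcs
  have hsum : Summable fun x : V => ‖ξ x‖ * ‖∑' y : V, (c x y : ℂ) * (u x - u y)‖ :=
    hcs.1.of_nonneg_of_le (fun x => by positivity) hle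
  refine ⟨habs, hsum, (hsum.tsum_le_tsum hle hcs.1).trans ?_⟩
  rw [hu.tsum_prod]
  exact hcs.2
end
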